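/- Let A be an essential central arrangement of d hyperplanes of rank n with defining linear forms α_1,…,α_d, and let I ⊆ R = K[y_1,…,y_d] be its Orlik–Terao ideal. Then I is a prime ideal; moreover I equals the kernel of the K-algebra homomorphism Φ: R → K[1/α_1,…,1/α_d] defined by y_i ↦ 1/α_i, the field of fractions of R/I is a purely transcendental extension of K of transcendence degree n (so V(I) is a rational variety), and I has codimension d − n in R. -/

import Mathlib

open MvPolynomial

/-- An essential central arrangement of hyperplanes in `K^n`, with hyperplanes indexed by `ι`:
the hyperplane `H i` is the kernel of the nonzero linear form with coefficient vector `form i`,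
the forms are pairwise non-proportional (the hyperplanes are distinct), and they span the dual
space (the arrangement is essential, i.e. has rank `n`). -/
structure CentralArrangement (K : Type*) [Field K] (ι : Type*) [Fintype ι] (n : ℕ) where
  form : ι → (Fin n → K)
  nonzero : ∀ i, form i ≠ 0
  nonProportional : ∀ i j, i ≠ j → ∀ t : K, form i ≠ t • form j
  essential : Submodule.span K (Set.range form) = ⊤

namespace CentralArrangement

variable {K : Type*} [Field K] {ι : Type*} [Fintype ι] {n : ℕ}

/-- The evaluation map `K^ι → K[x_1,…,x_n]_1 ≅ K^n`, sending `e i` to the form `α i`. -/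
noncomputable def evalMap (A : CentralArrangement K ι n) : (ι → K) →ₗ[K] (Fin n → K) where
  toFun c := ∑ i, c i • A.form i
  map_add' x y := by
    simp [add_smul, Finset.sum_add_distrib]
  map_smul' t x := by
    simp [smul_smul, Finset.smul_sum]

/-- The relation space `F(A)`: the kernel of the evaluation map. -/
noncomputable def relSpace (A : CentralArrangement K ι n) : Submodule K (ι → K) :=
  LinearMap.ker A.evalMap

end CentralArrangement

open Classical in
/-- The support of a vector `c : ι → K`, as a finset. -/
noncomputable def vsupp {K ι : Type*} [Field K] [Fintype ι] (c : ι → K) : Finset ι :=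
  Finset.univ.filter fun j => c j ≠ 0

/-- The Orlik-Terao boundary `∂(c) = Σ_{j ∈ Λ} c_j · Π_{l ∈ Λ, l ≠ j} y_l`, where
`Λ` is the support of the dependency `c`. -/
noncomputable def otgen {K ι : Type*} [Field K] [Fintype ι] [DecidableEq ι] (c : ι → K) :
    MvPolynomial ι K :=
  ∑ j ∈ vsupp c, MvPolynomial.C (c j) * ∏ l ∈ (vsupp c).erase j, MvPolynomial.X l

namespace CentralArrangement

variable {K : Type*} [Field K] {ι : Type*} [Fintype ι] [DecidableEq ι] {n : ℕ}

/-- The Orlik-Terao ideal `I`, generated by `∂(c)` for all relations `c ∈ F(A)`. -/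
noncomputable def otIdeal (A : CentralArrangement K ι n) : Ideal (MvPolynomial ι K) :=
  Ideal.span (otgen '' (A.relSpace : Set (ι → K)))

/-- The quadratic component `I₂` of the Orlik-Terao ideal: the ideal generated by the
degree-2 (homogeneous) elements of `I`. -/
noncomputable def otQuadratic (A : CentralArrangement K ι n) : Ideal (MvPolynomial ι K) :=
  Ideal.span {f | f ∈ A.otIdeal ∧ f.IsHomogeneous 2}

/-- A 3-relation is an element of `F(A)` with support of size 3; the arrangement is
2-formal if the 3-relations span the relation space. -/
def IsTwoFormal (A : CentralArrangement K ι n) : Prop :=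
  Submodule.span K {c : ι → K | c ∈ A.relSpace ∧ (vsupp c).card = 3} = A.relSpace

end CentralArrangement

open MvPolynomial

section RelationIdeal

variable {K : Type*} [Field K]

/-- The ideal generated by the boundaries `∂(c)` of all linear relations `c` among a family `v`
of vectors. -/
noncomputable def relationIdeal {ι V : Type*} [Fintype ι] [DecidableEq ι] [AddCommGroup V]
    [Module K V] (v : ι → V) : Ideal (MvPolynomial ι K) :=
  Ideal.span (otgen '' {c : ι → K | ∑ i, c i • v i = 0})

theorem mem_vsupp {ι : Type*} [Fintype ι] {c : ι → K} {i : ι} : i ∈ vsupp c ↔ c i ≠ 0 := by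
  simp [vsupp]

theorem otgen_mem_relationIdeal {ι V : Type*} [Fintype ι] [DecidableEq ι] [AddCommGroup V]
    [Module K V] {v : ι → V} {c : ι → K} (hc : ∑ i, c i • v i = 0) :
    otgen c ∈ relationIdeal (K := K) v :=
  Ideal.subset_span ⟨c, hc, rfl⟩

theorem aeval_inv_otgen {ι L : Type*} [Fintype ι] [DecidableEq ι] [Field L] [Algebra K L]
    {b : ι → L} (hb : ∀ i, b i ≠ 0) {c : ι → K} (hc : ∑ i, c i • b i = 0) :
    aeval (fun i => (b i)⁻¹) (otgen c) = 0 := by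
  have hterm : ∀ j ∈ vsupp c,
      algebraMap K L (c j) * ∏ l ∈ (vsupp c).erase j, (b l)⁻¹ =
        (c j • b j) * ∏ l ∈ vsupp c, (b l)⁻¹ := by
    intro j hj
    rw [← Finset.mul_prod_erase _ _ hj, Algebra.smul_def]
    field_simp [hb j]
  have hsum : ∑ j ∈ vsupp c, c j • b j = 0 := by
    rw [← hc]
    refine Finset.sum_subset (Finset.subset_univ _) fun j _ hj => ?_
    rw [mem_vsupp, not_not] at hj
    simp [hj]
  simp only [otgen, map_sum, map_mul, map_prod, aeval_X, ← algebraMap_eq, AlgHom.commutes]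
  rw [Finset.sum_congr rfl hterm, ← Finset.sum_mul, hsum, zero_mul]

theorem aeval_inv_eq_zero_of_mem_relationIdeal {ι V L : Type*} [Fintype ι] [DecidableEq ι]
    [AddCommGroup V] [Module K V] [Field L] [Algebra K L] {v : ι → V} (φ : V →ₗ[K] L)
    (hφ : ∀ i, φ (v i) ≠ 0) {f : MvPolynomial ι K} (hf : f ∈ relationIdeal v) :
    aeval (fun i => (φ (v i))⁻¹) f = 0 := by
  suffices h : relationIdeal v ≤ RingHom.ker (aeval (R := K) fun i => (φ (v i))⁻¹) from h hf
  refine Ideal.span_le.2 ?_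
  rintro _ ⟨c, hc, rfl⟩
  refine aeval_inv_otgen hφ ?_
  simpa using congrArg φ hc

theorem relationIdeal_comp_of_injective {ι V W : Type*} [Fintype ι] [DecidableEq ι]
    [AddCommGroup V] [Module K V] [AddCommGroup W] [Module K W] (v : ι → V) (φ : V →ₗ[K] W)
    (hφ : Function.Injective φ) :
    relationIdeal (K := K) (fun i => φ (v i)) = relationIdeal v := by
  have h : ∀ c : ι → K, ∑ i, c i • φ (v i) = φ (∑ i, c i • v i) := by simp
  simp only [relationIdeal, h, map_eq_zero_iff φ hφ]

/-! ### Deletion and contraction of the first vector -/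

variable {d : ℕ}

theorem vsupp_cons_zero (c : Fin d → K) :
    vsupp (Fin.cons 0 c : Fin (d + 1) → K) = (vsupp c).map (Fin.succEmb d) := by
  ext i
  refine Fin.cases ?_ (fun i => ?_) i <;> simp [mem_vsupp]

theorem vsupp_cons_of_ne_zero {a : K} (ha : a ≠ 0) (c : Fin d → K) :
    vsupp (Fin.cons a c : Fin (d + 1) → K) =
      insert 0 ((vsupp c).map (Fin.succEmb d)) := by
  ext i
  refine Fin.cases ?_ (fun i => ?_) i <;> simp [mem_vsupp, ha]

theorem otgen_cons_zero (c : Fin d → K) :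
    otgen (Fin.cons 0 c : Fin (d + 1) → K) = rename Fin.succ (otgen c) := by
  simp only [otgen, vsupp_cons_zero, Finset.sum_map, map_sum, map_mul, map_prod, rename_C,
    rename_X, Fin.coe_succEmb, Fin.cons_succ]
  refine Finset.sum_congr rfl fun j _ => ?_
  rw [show j.succ = Fin.succEmb d j from rfl, ← Finset.map_erase, Finset.prod_map]
  simp only [Fin.coe_succEmb]

theorem otgen_cons_of_ne_zero {a : K} (ha : a ≠ 0) (c : Fin d → K) :
    otgen (Fin.cons a c : Fin (d + 1) → K) =
      rename Fin.succ (C a * ∏ l ∈ vsupp c, X l) + X 0 * rename Fin.succ (otgen c) := by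
  have h0 : (0 : Fin (d + 1)) ∉ (vsupp c).map (Fin.succEmb d) := by simp
  simp only [otgen, vsupp_cons_of_ne_zero ha, Finset.sum_insert h0, Finset.erase_insert h0,
    Finset.sum_map, map_sum, map_mul, map_prod, rename_C, rename_X, Finset.prod_map,
    Fin.coe_succEmb, Fin.cons_succ, Fin.cons_zero, Finset.mul_sum]
  congr 1
  refine Finset.sum_congr rfl fun j _ => ?_
  rw [Finset.erase_insert_of_ne (Fin.succ_ne_zero j).symm,
    Finset.prod_insert (fun h => h0 (Finset.mem_of_mem_erase h))]
  rw [show j.succ = Fin.succEmb d j from rfl, ← Finset.map_erase, Finset.prod_map]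
  simp only [Fin.coe_succEmb]
  ring

theorem rename_succ_mem_relationIdeal {V : Type*} [AddCommGroup V] [Module K V]
    {v : Fin (d + 1) → V} {f : MvPolynomial (Fin d) K}
    (hf : f ∈ relationIdeal (fun i : Fin d => v i.succ)) :
    rename Fin.succ f ∈ relationIdeal v := by
  suffices h : relationIdeal (fun i : Fin d => v i.succ) ≤
      (relationIdeal v).comap (rename (R := K) Fin.succ) from h hf
  refine Ideal.span_le.2 ?_
  rintro _ ⟨c, hc, rfl⟩
  change rename Fin.succ (otgen c) ∈ relationIdeal v
  rw [← otgen_cons_zero]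
  refine otgen_mem_relationIdeal ?_
  simpa [Fin.sum_univ_succ] using hc

variable {W : Type*} [AddCommGroup W] [Module K W]

/-- A functional vanishing on the kernel of `φ` is a multiple of `φ`. -/
theorem exists_eq_smul_of_domRestrict_ker_eq_zero {φ ψ : Module.Dual K W} (hφ : φ ≠ 0)
    (h : ψ.domRestrict (LinearMap.ker φ) = 0) : ∃ a : K, ψ = a • φ := by
  obtain ⟨u, hu⟩ := LinearMap.surjective hφ 1
  refine ⟨ψ u, LinearMap.ext fun w => ?_⟩
  have hw : w - φ w • u ∈ LinearMap.ker φ := by simp [hu]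
  have := LinearMap.congr_fun h ⟨_, hw⟩
  simp only [LinearMap.domRestrict_apply, map_sub, map_smul, LinearMap.zero_apply, sub_eq_zero,
    smul_eq_mul] at this
  simp [this, mul_comm]

theorem exists_X_zero_mul_rename_sub_mem_relationIdeal {α : Fin (d + 1) → Module.Dual K W}
    (h0 : α 0 ≠ 0) {g : MvPolynomial (Fin d) K}
    (hg : g ∈ relationIdeal (fun i : Fin d => (α i.succ).domRestrict (LinearMap.ker (α 0)))) :
    ∃ h : MvPolynomial (Fin d) K,
      X 0 * rename Fin.succ g - rename Fin.succ h ∈ relationIdeal α := by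
  induction hg using Submodule.span_induction with
  | mem x hx =>
    obtain ⟨c, hc, rfl⟩ := hx
    obtain ⟨a, ha⟩ := exists_eq_smul_of_domRestrict_ker_eq_zero
      (ψ := ∑ i : Fin d, c i • α i.succ) h0 (by
        ext w
        simpa using LinearMap.congr_fun hc w)
    have hrel : ∑ i, (Fin.cons (-a) c : Fin (d + 1) → K) i • α i = 0 := by
      rw [Fin.sum_univ_succ]
      simp only [Fin.cons_zero, Fin.cons_succ, ha]
      ext w
      simp
    have hmem := otgen_mem_relationIdeal hrel
    by_cases ha0 : a = 0
    · subst ha0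
      rw [neg_zero, otgen_cons_zero] at hmem
      exact ⟨0, by simpa using Ideal.mul_mem_left _ (X 0) hmem⟩
    · rw [otgen_cons_of_ne_zero (neg_ne_zero.2 ha0)] at hmem
      refine ⟨-(C (-a) * ∏ l ∈ vsupp c, X l), ?_⟩
      rwa [map_neg, sub_neg_eq_add, add_comm (X 0 * _)]
  | zero => exact ⟨0, by simp⟩
  | add x y _ _ hx hy =>
    obtain ⟨h₁, hh₁⟩ := hx
    obtain ⟨h₂, hh₂⟩ := hy
    refine ⟨h₁ + h₂, ?_⟩
    convert Ideal.add_mem _ hh₁ hh₂ using 1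
    simp only [map_add]
    ring
  | smul b x _ hx =>
    obtain ⟨h, hh⟩ := hx
    refine ⟨b * h, ?_⟩
    convert Ideal.mul_mem_left _ (rename Fin.succ b) hh using 1
    simp only [smul_eq_mul, map_mul]
    ring

/-- If the first vector is parallel to a later one, its variable can be eliminated. -/
theorem exists_sub_rename_succ_mem_relationIdeal {V : Type*} [AddCommGroup V] [Module K V]
    {v : Fin (d + 1) → V} {i : Fin d} {a : K} (ha : a ≠ 0) (hi : v i.succ = a • v 0)
    (f : MvPolynomial (Fin (d + 1)) K) :
    ∃ g : MvPolynomial (Fin d) K, f - rename Fin.succ g ∈ relationIdeal v := by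
  have hs : vsupp (Pi.single i (1 : K)) = {i} := by
    ext j
    simp [mem_vsupp, Pi.single_apply]
  have hmem : X 0 - rename Fin.succ (C a * X i) ∈ relationIdeal (K := K) v := by
    have := otgen_mem_relationIdeal (K := K) (v := v)
      (c := Fin.cons (-a) (Pi.single i (1 : K))) (by
        simp [Fin.sum_univ_succ, Pi.single_apply, hi])
    rw [otgen_cons_of_ne_zero (neg_ne_zero.2 ha)] at this
    simp only [otgen, hs, Finset.prod_singleton, Finset.sum_singleton, Finset.erase_singleton,
      Finset.prod_empty, Pi.single_eq_same] at this
    convert this using 1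
    simp
    ring
  induction f using MvPolynomial.induction_on with
  | C b => exact ⟨C b, by simp⟩
  | add p q hp hq =>
    obtain ⟨g₁, h₁⟩ := hp
    obtain ⟨g₂, h₂⟩ := hq
    refine ⟨g₁ + g₂, ?_⟩
    convert Ideal.add_mem _ h₁ h₂ using 1
    simp only [map_add]
    ring
  | mul_X p j hp =>
    obtain ⟨g, hg⟩ := hp
    refine Fin.cases ?_ (fun j => ?_) j
    · refine ⟨g * (C a * X i), ?_⟩
      convert Ideal.add_mem _ (Ideal.mul_mem_right (X 0) _ hg)
        (Ideal.mul_mem_left _ (rename Fin.succ g) hmem) using 1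
      simp only [map_mul]
      ring
    · refine ⟨g * X j, ?_⟩
      convert Ideal.mul_mem_right (X j.succ) _ hg using 1
      simp only [map_mul, rename_X]
      ring

/-! ### Regular functions -/

/-- If each `s i` is a fraction with denominator in `M`, so is every polynomial in the `s i`. -/
theorem exists_eval₂_mul_eq_of_forall_exists {A B σ : Type*} [CommRing A] [CommRing B]
    (φ : A →+* B) (ψ : K →+* A) (M : Submonoid A) {s : σ → B}
    (hs : ∀ i, ∃ q ∈ M, ∃ p, s i * φ q = φ p) (f : MvPolynomial σ K) :
    ∃ q ∈ M, ∃ p, eval₂ (φ.comp ψ) s f * φ q = φ p := by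
  induction f using MvPolynomial.induction_on with
  | C b => exact ⟨1, M.one_mem, ψ b, by simp⟩
  | add f g hf hg =>
    obtain ⟨q₁, hq₁, p₁, h₁⟩ := hf
    obtain ⟨q₂, hq₂, p₂, h₂⟩ := hg
    refine ⟨q₁ * q₂, M.mul_mem hq₁ hq₂, p₁ * q₂ + p₂ * q₁, ?_⟩
    simp only [eval₂_add, map_add, map_mul, ← h₁, ← h₂]
    ring
  | mul_X f i hf =>
    obtain ⟨q₁, hq₁, p₁, h₁⟩ := hf
    obtain ⟨q₂, hq₂, p₂, h₂⟩ := hs i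
    refine ⟨q₁ * q₂, M.mul_mem hq₁ hq₂, p₁ * p₂, ?_⟩
    simp only [eval₂_mul, eval₂_X, map_mul, ← h₁, ← h₂]
    ring

/-- A polynomial identity between reciprocals of univariate polynomials and the parameter which
holds away from finitely many points extends to `0` when the polynomials do not vanish there. -/
theorem eval_zero_eq_zero_of_cofinite [Infinite K] {p : Fin d → Polynomial K}
    (hp : ∀ i, (p i).eval 0 ≠ 0) (f : MvPolynomial (Fin (d + 1)) K)
    (hf : ∀ t, t ≠ 0 → (∀ i, (p i).eval t ≠ 0) →
      eval (Fin.cons t fun i => ((p i).eval t)⁻¹) f = 0) :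
    eval (Fin.cons 0 fun i => ((p i).eval 0)⁻¹) f = 0 := by
  let φ : Polynomial K →+* (K → K) := RingHom.pi fun t => Polynomial.evalRingHom t
  let M : Submonoid (Polynomial K) :=
    (nonZeroDivisors K).comap (Polynomial.evalRingHom (0 : K))
  have hφ : ∀ q t, φ q t = q.eval t := fun _ _ => rfl
  have hM : ∀ q, q ∈ M ↔ q.eval 0 ≠ 0 := fun q => by
    simp [M, Submonoid.mem_comap, mem_nonZeroDivisors_iff_ne_zero]
  let s : Fin (d + 1) → K → K := Fin.cons id fun i t => ((p i).eval t)⁻¹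
  have hs : ∀ i, ∃ q ∈ M, ∃ r, s i * φ q = φ r := by
    refine Fin.cases ?_ fun i => ?_
    · exact ⟨1, M.one_mem, Polynomial.X, by ext t; simp [s, hφ]⟩
    · refine ⟨p i ^ 2, M.pow_mem ((hM _).2 (hp i)) 2, p i, ?_⟩
      ext t
      by_cases ht : (p i).eval t = 0
      · simp [s, hφ, ht]
      · simp [s, hφ, ht, sq]
  obtain ⟨q, hq, r, h⟩ := exists_eval₂_mul_eq_of_forall_exists φ Polynomial.C M hs f
  have hs' : ∀ t, (fun i => s i t) = Fin.cons t fun i => ((p i).eval t)⁻¹ := fun t => by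
    ext i
    refine Fin.cases ?_ (fun i => ?_) i <;> simp [s]
  have key : ∀ t, eval (Fin.cons t fun i => ((p i).eval t)⁻¹) f * q.eval t = r.eval t := by
    intro t
    have := congrFun h t
    have he : eval₂ (φ.comp Polynomial.C) s f t = eval (fun i => s i t) f := by
      have hC : (Pi.evalRingHom (fun _ : K => K) t).comp (φ.comp Polynomial.C) = RingHom.id K := by
        ext x
        simp [hφ]
      exact (hom_eval₂ f _ (Pi.evalRingHom (fun _ : K => K) t) s).trans (by rw [hC]; rfl)
    rw [Pi.mul_apply, he, hs'] at this
    simpa [hφ] using this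
  have hr : r * (Polynomial.X * ∏ i, p i) = 0 := by
    refine Polynomial.funext fun t => ?_
    rw [Polynomial.eval_mul, Polynomial.eval_zero, mul_eq_zero, or_iff_not_imp_right]
    intro ht
    simp only [Polynomial.eval_mul, Polynomial.eval_X, Polynomial.eval_prod, mul_ne_zero_iff,
      Finset.prod_ne_zero_iff, Finset.mem_univ, true_implies] at ht
    rw [← key, hf t ht.1 ht.2, zero_mul]
  have hr0 : r = 0 := by
    refine (mul_eq_zero.1 hr).resolve_right (mul_ne_zero Polynomial.X_ne_zero ?_)
    refine Finset.prod_ne_zero_iff.2 fun i _ h => hp i ?_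
    simp [h]
  have := key 0
  rw [hr0, Polynomial.eval_zero] at this
  exact (mul_eq_zero.1 this).resolve_right ((hM q).1 hq)

/-! ### The vanishing ideal of the reciprocal points -/

theorem eval_leadingCoeff_eq_zero [Infinite K] {α : Fin (d + 1) → Module.Dual K W}
    (h0 : α 0 ≠ 0) {f : MvPolynomial (Fin (d + 1)) K}
    (hf : ∀ w, (∀ i, α i w ≠ 0) → eval (fun i => (α i w)⁻¹) f = 0)
    {w : W} (hw : α 0 w = 0) (hw' : ∀ i : Fin d, α i.succ w ≠ 0) :
    eval (fun i : Fin d => (α i.succ w)⁻¹) (finSuccEquiv K d f).leadingCoeff = 0 := by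
  obtain ⟨u, hu⟩ := LinearMap.surjective h0 1
  let p : Fin d → Polynomial K := fun i =>
    Polynomial.C (α i.succ w) + Polynomial.C (α i.succ u) * Polynomial.X
  have hp : ∀ i t, (p i).eval t = α i.succ (w + t • u) := fun i t => by
    simp only [p, Polynomial.eval_add, Polynomial.eval_mul, Polynomial.eval_C, Polynomial.eval_X,
      map_add, map_smul, smul_eq_mul, mul_comm]
  have := eval_zero_eq_zero_of_cofinite (p := p) (fun i => by simpa [hp] using hw' i)
    ((finSuccEquiv K d).symm (finSuccEquiv K d f).reverse) (by
      intro t ht h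
      have h1 : α 0 (w + t • u) = t := by simp [hw, hu]
      have h2 := hf (w + t • u) (Fin.cases (by rwa [h1]) fun i => by rw [← hp]; exact h i)
      have h3 : (fun i => (α i (w + t • u))⁻¹) =
          (Fin.cons t⁻¹ fun i => ((p i).eval t)⁻¹ : Fin (d + 1) → K) := by
        ext i
        refine Fin.cases ?_ (fun i => ?_) i
        · simp only [h1, Fin.cons_zero]
        · simp only [hp, Fin.cons_succ]
      rw [h3, eval_eq_eval_mv_eval', Polynomial.eval_map] at h2
      rw [eval_eq_eval_mv_eval', AlgEquiv.apply_symm_apply, Polynomial.eval_map]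
      let _ : Invertible t⁻¹ := invertibleOfNonzero (inv_ne_zero ht)
      have h4 := (Polynomial.eval₂_reverse_eq_zero_iff
        (eval fun i => ((p i).eval t)⁻¹) t⁻¹ (finSuccEquiv K d f)).2 h2
      simpa using h4)
  rw [eval_eq_eval_mv_eval', AlgEquiv.apply_symm_apply, Polynomial.eval_map,
    Polynomial.eval₂_at_zero, Polynomial.coeff_zero_reverse] at this
  simpa only [hp, zero_smul, add_zero] using this

theorem finSuccEquiv_rename_succ (g : MvPolynomial (Fin d) K) :
    finSuccEquiv K d (rename Fin.succ g) = Polynomial.C g := by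
  induction g using MvPolynomial.induction_on with
  | C a => simp [finSuccEquiv_apply]
  | add p q hp hq => simp only [map_add, hp, hq]
  | mul_X p i hp => simp only [map_mul, rename_X, hp, finSuccEquiv_X_succ]

theorem eval_inv_eq_zero_of_mem_relationIdeal {α : Fin d → Module.Dual K W}
    {f : MvPolynomial (Fin d) K} (hf : f ∈ relationIdeal α) {w : W} (hw : ∀ i, α i w ≠ 0) :
    eval (fun i => (α i w)⁻¹) f = 0 := by
  simpa [aeval_eq_eval] using
    aeval_inv_eq_zero_of_mem_relationIdeal (Module.Dual.eval K W w) hw hf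

/-- A polynomial which vanishes at all points `(1 / α i w)` lies in the relation ideal of `α`.
The proof is by deletion and contraction of the first functional. -/
theorem mem_relationIdeal_of_forall_eval_eq_zero [Infinite K] (d : ℕ) {W : Type*}
    [AddCommGroup W] [Module K W] {α : Fin d → Module.Dual K W} (hα : ∀ i, α i ≠ 0)
    {f : MvPolynomial (Fin d) K}
    (hf : ∀ w, (∀ i, α i w ≠ 0) → eval (fun i => (α i w)⁻¹) f = 0) :
    f ∈ relationIdeal α := by
  induction d generalizing W with
  | zero =>
    have := hf 0 (fun i => i.elim0)
    rw [eq_C_of_isEmpty f, eval_C] at this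
    rw [eq_C_of_isEmpty f, this, map_zero]
    exact Ideal.zero_mem _
  | succ d ih =>
    have hvanish : ∀ f' : MvPolynomial (Fin (d + 1)) K, f - f' ∈ relationIdeal α →
        ∀ w, (∀ i, α i w ≠ 0) → eval (fun i => (α i w)⁻¹) f' = 0 := by
      intro f' hf' w hw
      have := eval_inv_eq_zero_of_mem_relationIdeal hf' hw
      rwa [map_sub, hf w hw, zero_sub, neg_eq_zero] at this
    by_cases hpar : ∃ i : Fin d, (α i.succ).domRestrict (LinearMap.ker (α 0)) = 0
    · obtain ⟨i, hi⟩ := hpar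
      obtain ⟨a, ha⟩ := exists_eq_smul_of_domRestrict_ker_eq_zero (hα 0) hi
      have ha0 : a ≠ 0 := by
        rintro rfl
        exact hα i.succ (by rw [ha, zero_smul])
      obtain ⟨g, hg⟩ := exists_sub_rename_succ_mem_relationIdeal (v := α) ha0 ha f
      refine (Submodule.sub_mem_iff_left _ (rename_succ_mem_relationIdeal
        (ih (fun i => hα i.succ) fun w hw => ?_))).1 hg
      have h0 : α 0 w ≠ 0 := fun h => hw i (by simp [ha, h])
      simpa [eval_rename, Function.comp_def] using hvanish _ hg w (Fin.cases h0 hw)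
    · push Not at hpar
      suffices key : ∀ (N : ℕ) (f : MvPolynomial (Fin (d + 1)) K),
          (finSuccEquiv K d f).natDegree ≤ N →
          (∀ w, (∀ i, α i w ≠ 0) → eval (fun i => (α i w)⁻¹) f = 0) → f ∈ relationIdeal α from
        key _ f le_rfl hf
      clear hvanish hf f
      intro N
      induction N with
      | zero =>
        intro f hN hf
        have hC := Polynomial.eq_C_of_natDegree_le_zero hN
        set g := (finSuccEquiv K d f).coeff 0
        have hfg : f = rename Fin.succ g :=
          (finSuccEquiv K d).injective (by rw [hC, finSuccEquiv_rename_succ])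
        rw [hfg]
        refine rename_succ_mem_relationIdeal (ih (fun i => hα i.succ) fun w hw => ?_)
        by_cases h0 : α 0 w = 0
        · simpa [hC] using eval_leadingCoeff_eq_zero (hα 0) hf h0 hw
        · simpa [hfg, eval_rename, Function.comp_def] using hf w (Fin.cases h0 hw)
      | succ N ihN =>
        intro f hN hf
        rcases hN.lt_or_eq with hlt | heq
        · exact ihN f (Nat.lt_succ_iff.1 hlt) hf
        set l := (finSuccEquiv K d f).leadingCoeff with hl
        have hl_mem := ih (α := fun i : Fin d => (α i.succ).domRestrict (LinearMap.ker (α 0)))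
          hpar (f := l) fun w hw => eval_leadingCoeff_eq_zero (hα 0) hf w.2 hw
        obtain ⟨h, hh⟩ := exists_X_zero_mul_rename_sub_mem_relationIdeal (hα 0) hl_mem
        have hmem := Ideal.mul_mem_left (relationIdeal α) (X 0 ^ N) hh
        refine (Submodule.sub_mem_iff_left _ hmem).1 (ihN _ ?_ fun w hw => ?_)
        · simp only [map_sub, map_mul, map_pow, finSuccEquiv_X_zero, finSuccEquiv_rename_succ]
          refine Polynomial.natDegree_le_iff_coeff_eq_zero.2 fun m hm => ?_
          obtain ⟨m, rfl⟩ := Nat.exists_eq_add_of_lt hm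
          rw [mul_sub, ← mul_assoc, ← pow_succ, Polynomial.coeff_sub, Polynomial.coeff_sub,
            Polynomial.coeff_X_pow_mul', Polynomial.coeff_X_pow_mul', Polynomial.coeff_C,
            Polynomial.coeff_C]
          rcases Nat.eq_zero_or_pos m with rfl | hm0
          · rw [hl, Polynomial.leadingCoeff, heq]
            simp
          · rw [Polynomial.coeff_eq_zero_of_natDegree_lt (by omega)]
            simp [show N + m + 1 - N ≠ 0 by omega, hm0.ne']
        · rw [map_sub, hf w hw, eval_inv_eq_zero_of_mem_relationIdeal hmem hw, sub_zero]

/-! ### The kernel of the parametrization -/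

/-- The linear form with a given coefficient vector, as a rational function. -/
noncomputable def rationalForm (K : Type*) [Field K] (n : ℕ) :
    (Fin n → K) →ₗ[K] FractionRing (MvPolynomial (Fin n) K) :=
  (IsScalarTower.toAlgHom K (MvPolynomial (Fin n) K)
    (FractionRing (MvPolynomial (Fin n) K))).toLinearMap ∘ₗ
      Fintype.linearCombination K (X : Fin n → MvPolynomial (Fin n) K)

variable {n : ℕ}

theorem rationalForm_apply (v : Fin n → K) :
    rationalForm K n v = algebraMap (MvPolynomial (Fin n) K)
      (FractionRing (MvPolynomial (Fin n) K)) (∑ j, C (v j) * X j) := by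
  simp [rationalForm, Fintype.linearCombination_apply, smul_eq_C_mul]

theorem rationalForm_injective : Function.Injective (rationalForm K n) := by
  refine (IsFractionRing.injective (MvPolynomial (Fin n) K) _).comp ?_
  exact linearIndependent_iff_injective_fintypeLinearCombination.1 (linearIndependent_X (Fin n) K)

theorem relationIdeal_eq_ker [Infinite K] {v : Fin d → Fin n → K} (hv : ∀ i, v i ≠ 0) :
    relationIdeal v = RingHom.ker (aeval (R := K) fun i => (rationalForm K n (v i))⁻¹) := by
  have hform : ∀ i, rationalForm K n (v i) ≠ 0 := fun i =>
    (map_ne_zero_iff _ rationalForm_injective).2 (hv i)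
  refine le_antisymm (fun f hf => aeval_inv_eq_zero_of_mem_relationIdeal _ hform hf)
    fun f hf => ?_
  have hinj : Function.Injective (dotProductBilin K K : (Fin n → K) →ₗ[K] _) := by
    intro x y hxy
    ext j
    simpa using LinearMap.congr_fun hxy (Pi.single j 1)
  rw [← relationIdeal_comp_of_injective v _ hinj]
  refine mem_relationIdeal_of_forall_eval_eq_zero d
    (fun i => (map_ne_zero_iff _ hinj).2 (hv i)) fun w hw => ?_
  let L := FractionRing (MvPolynomial (Fin n) K)
  let φ : MvPolynomial (Fin n) K →+* L × K := (algebraMap _ L).prod (eval w)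
  let M : Submonoid (MvPolynomial (Fin n) K) := (nonZeroDivisors K).comap (eval w)
  have hM : ∀ q, q ∈ M ↔ eval w q ≠ 0 := fun q => by
    simp [M, Submonoid.mem_comap, mem_nonZeroDivisors_iff_ne_zero]
  let s : Fin d → L × K := fun i => ((rationalForm K n (v i))⁻¹, (dotProductBilin K K (v i) w)⁻¹)
  have hw' : ∀ i, eval w (∑ j, C (v i j) * X j) = dotProductBilin K K (v i) w := fun i => by
    simp [dotProduct]
  obtain ⟨q, hq, p, h⟩ := exists_eval₂_mul_eq_of_forall_exists φ C M (s := s) (fun i => by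
    refine ⟨∑ j, C (v i j) * X j, (hM _).2 (by rw [hw']; exact hw i), 1, ?_⟩
    refine Prod.ext ?_ ?_
    · simp only [s, φ, Prod.fst_mul, RingHom.prod_apply, map_one, L]
      rw [← rationalForm_apply]
      exact inv_mul_cancel₀ (hform i)
    · simp only [s, φ, Prod.snd_mul, RingHom.prod_apply, hw', map_one]
      exact inv_mul_cancel₀ (hw i)) f
  have h1 : (eval₂ (φ.comp C) s f).1 = aeval (fun i => (rationalForm K n (v i))⁻¹) f :=
    hom_eval₂ f _ (RingHom.fst L K) s
  have h2 : (eval₂ (φ.comp C) s f).2 = eval (fun i => (dotProductBilin K K (v i) w)⁻¹) f := by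
    have hC : (RingHom.snd L K).comp (φ.comp C) = RingHom.id K := by
      ext x
      simp [φ]
    exact (hom_eval₂ f _ (RingHom.snd L K) s).trans (by rw [hC]; rfl)
  have hp : p = 0 := by
    have := congrArg Prod.fst h
    rw [Prod.fst_mul, h1, RingHom.mem_ker.1 hf, zero_mul] at this
    exact (map_eq_zero_iff _ (IsFractionRing.injective (MvPolynomial (Fin n) K) L)).1 this.symm
  have := congrArg Prod.snd h
  rw [Prod.snd_mul, h2, hp, map_zero] at this
  exact (mul_eq_zero.1 this).resolve_right ((hM q).1 hq)

/-- The reciprocals of linear forms spanning all linear forms generate the field of rational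
functions. -/
theorem fieldRange_eq_top_of_span_eq_top {F : Type*} [Field F] [Algebra K F]
    {v : Fin d → Fin n → K} (hspan : Submodule.span K (Set.range v) = ⊤)
    (ψ : F →ₐ[K] FractionRing (MvPolynomial (Fin n) K))
    (hψ : ∀ i, (rationalForm K n (v i))⁻¹ ∈ ψ.fieldRange) : ψ.fieldRange = ⊤ := by
  have hlin : ∀ u, rationalForm K n u ∈ ψ.fieldRange := by
    intro u
    have hu : u ∈ Submodule.span K (Set.range v) := hspan ▸ Submodule.mem_top
    induction hu using Submodule.span_induction with
    | mem x hx =>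
      obtain ⟨i, rfl⟩ := hx
      simpa using inv_mem (hψ i)
    | zero => simp
    | add x y _ _ hx hy => simpa using add_mem hx hy
    | smul a x _ hx => simpa using ψ.fieldRange.smul_mem hx
  have hpoly : ∀ p : MvPolynomial (Fin n) K, algebraMap _ _ p ∈ ψ.fieldRange := by
    intro p
    induction p using MvPolynomial.induction_on with
    | C a =>
      rw [← algebraMap_eq, ← IsScalarTower.algebraMap_apply]
      exact ψ.fieldRange.algebraMap_mem a
    | add p q hp hq => simpa using add_mem hp hq
    | mul_X p i hp =>
      rw [map_mul]
      refine mul_mem hp ?_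
      convert hlin (Pi.single i 1) using 1
      rw [rationalForm_apply]
      simp [Pi.single_apply]
  refine eq_top_iff.2 fun z _ => ?_
  obtain ⟨x, y, _, rfl⟩ := IsFractionRing.div_surjective (MvPolynomial (Fin n) K) z
  exact div_mem (hpoly x) (hpoly y)

end RelationIdeal

/-! ### Krull dimension of affine domains -/

theorem ringKrullDim_eq_of_isIntegral (R S : Type*) [CommRing R] [CommRing S] [Algebra R S]
    [Algebra.IsIntegral R S] [FaithfulSMul R S] : ringKrullDim S = ringKrullDim R := by
  refine le_antisymm (Order.krullDim_le_of_strictMono (PrimeSpectrum.comap (algebraMap R S))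
    fun I J h => Ideal.IsIntegral.comap_lt_comap h) (iSup_le fun l => ?_)
  obtain ⟨⟨P, hP, hPl⟩⟩ := Ideal.nonempty_primesOver (S := S) l.head.asIdeal
  obtain ⟨L, hL, -⟩ := Ideal.exists_ltSeries_of_hasGoingUp l P
  exact hL ▸ Order.LTSeries.length_le_krullDim L

theorem ringKrullDim_eq_of_trdeg_eq {K : Type*} (S : Type*) [Field K] [CommRing S] [IsDomain S]
    [Algebra K S] [Algebra.FiniteType K S] {n : ℕ} (h : Algebra.trdeg K S = n) :
    ringKrullDim S = n := by
  obtain ⟨s, g, hg, hint⟩ := exists_integral_inj_algHom_of_fg K S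
  let _ : Algebra (MvPolynomial (Fin s) K) S := g.toRingHom.toAlgebra
  have : IsScalarTower K (MvPolynomial (Fin s) K) S :=
    IsScalarTower.of_algebraMap_eq fun x => (g.commutes x).symm
  have : Algebra.IsIntegral (MvPolynomial (Fin s) K) S := ⟨hint⟩
  have : FaithfulSMul (MvPolynomial (Fin s) K) S :=
    (faithfulSMul_iff_algebraMap_injective _ _).2 hg
  have hs := lift_trdeg_add_eq K (MvPolynomial (Fin s) K) S
  rw [trdeg_eq_zero (R := MvPolynomial (Fin s) K) (A := S), MvPolynomial.trdeg_of_isDomain,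
    h] at hs
  simp only [Cardinal.mk_fin, Cardinal.lift_natCast, Cardinal.lift_zero, add_zero,
    Nat.cast_inj] at hs
  rw [ringKrullDim_eq_of_isIntegral (MvPolynomial (Fin s) K) S]
  simp [hs]

theorem FractionRing.trdeg_eq (K S : Type*) [Field K] [CommRing S] [IsDomain S] [Algebra K S] :
    Algebra.trdeg K (FractionRing S) = Algebra.trdeg K S := by
  have : Algebra.IsAlgebraic S (FractionRing S) :=
    IsLocalization.isAlgebraic _ (nonZeroDivisors S)
  rw [← trdeg_add_eq K S (A := FractionRing S), trdeg_eq_zero (R := S) (A := FractionRing S),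
    add_zero]

/-- Let `A` be an essential central arrangement of `d` hyperplanes of rank `n`
over a field `K` of characteristic 0, with Orlik-Terao ideal `I ⊆ R = K[y_1,…,y_d]`.  Then `I`
is prime; moreover `I` is the kernel of the `K`-algebra map `Φ : R → K(x_1,…,x_n)` sending
`y_i ↦ 1/α_i` (whose image is the subalgebra `K[1/α_1,…,1/α_d]`), the field of fractions of
`R/I` is a purely transcendental extension of `K` of transcendence degree `n` (i.e. isomorphic
as a `K`-algebra to the rational function field `K(x_1,…,x_n)`, so `V(I)` is rational), and
`I` has codimension `d − n` in `R`, i.e. the Krull dimension of `R/I` is `n`. -/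
theorem otIdeal_isPrime_ker_rational_codim
    (K : Type*) [Field K] [CharZero K] (d n : ℕ)
    (A : CentralArrangement K (Fin d) n) :
    A.otIdeal.IsPrime ∧
    A.otIdeal =
      RingHom.ker (MvPolynomial.aeval (R := K)
        (fun i : Fin d =>
          (algebraMap (MvPolynomial (Fin n) K) (FractionRing (MvPolynomial (Fin n) K))
              (∑ j, MvPolynomial.C (A.form i j) * MvPolynomial.X j))⁻¹)).toRingHom ∧
    Nonempty
      ((FractionRing (MvPolynomial (Fin d) K ⧸ A.otIdeal)) ≃ₐ[K]
        (FractionRing (MvPolynomial (Fin n) K))) ∧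
    ringKrullDim (MvPolynomial (Fin d) K ⧸ A.otIdeal) = (n : WithBot (WithTop ℕ)) := by
  let L := FractionRing (MvPolynomial (Fin n) K)
  let Φ : MvPolynomial (Fin d) K →ₐ[K] L := aeval fun i => (rationalForm K n (A.form i))⁻¹
  have hker : A.otIdeal = RingHom.ker Φ := relationIdeal_eq_ker A.nonzero
  have hprime : A.otIdeal.IsPrime := hker ▸ RingHom.ker_isPrime Φ
  let φ : (MvPolynomial (Fin d) K ⧸ A.otIdeal) →ₐ[K] L :=
    Ideal.Quotient.liftₐ A.otIdeal Φ fun x hx => by rwa [hker] at hx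
  have hφ : Function.Injective φ := by
    refine (injective_iff_map_eq_zero φ).2 fun x hx => ?_
    obtain ⟨x, rfl⟩ := Ideal.Quotient.mk_surjective x
    exact Ideal.Quotient.eq_zero_iff_mem.2 (hker ▸ hx)
  let ψ : FractionRing (MvPolynomial (Fin d) K ⧸ A.otIdeal) →ₐ[K] L :=
    IsFractionRing.liftAlgHom hφ
  have hψ : ψ.fieldRange = ⊤ := fieldRange_eq_top_of_span_eq_top A.essential ψ fun i => by
    refine ⟨algebraMap _ _ (Ideal.Quotient.mk A.otIdeal (X i)), ?_⟩
    exact (IsFractionRing.lift_algebraMap hφ _).trans (aeval_X _ i)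
  let e : FractionRing (MvPolynomial (Fin d) K ⧸ A.otIdeal) ≃ₐ[K] L :=
    AlgEquiv.ofBijective ψ ⟨ψ.injective, AlgHom.fieldRange_eq_top.1 hψ⟩
  refine ⟨hprime, ?_, ⟨e⟩, ringKrullDim_eq_of_trdeg_eq _ (K := K) ?_⟩
  · simp only [Φ, rationalForm_apply] at hker
    exact hker
  · rw [← FractionRing.trdeg_eq, e.trdeg_eq, FractionRing.trdeg_eq]
    simp
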